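/- arXiv:2512.07986 — 2 statements merged into one kernel-verified Lean document; each statement's English description precedes it below -/
import Mathlib

section
/- Let k₁,k₂ ≥ 1 and l₁,l₂ ≥ 0 be integers and set m₁ = k₂l₂+1, m₂ = k₁l₁+1, d₁ = k₁m₁, d₂ = k₂m₂. Let g₁,g₂ ∈ ℂ[t] with deg gᵢ ≤ lᵢ and gᵢ(1) = 1, write gᵢ(t) = Σ_{j=0}^{lᵢ} c_{i,j} t^j, and define Gᵢ(x,y) = Σ_{j=0}^{lᵢ} c_{i,j} y^{k₂ j} x^{k₁(lᵢ−j)}, u = x·G₁(x,y), v = y·G₂(x,y). Then for every s ∈ ℂ one has u(s^{k₂}, s^{k₁}) = s^{d₂} and v(s^{k₂}, s^{k₁}) = s^{d₁}; that is, the map F = (u,v) sends the parametrized curve t ↦ (t^{k₂}, t^{k₁}) (the curve x^{k₁} = y^{k₂}) onto the parametrized curve s ↦ (s^{d₂}, s^{d₁}) (the curve u^{d₁} = v^{d₂}). -/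
/-- The weighted homogenization of a polynomial `g` with `deg g ≤ l` takes the value
`s ^ (k₁ * k₂ * l) * g(1)` at the point `(s ^ k₂, s ^ k₁)`. -/
theorem eval_weighted_homogenization (k₁ k₂ l : ℕ) (g : Polynomial ℂ) (hg : g.natDegree ≤ l)
    (s : ℂ) :
    MvPolynomial.eval ![s ^ k₂, s ^ k₁] (∑ j ∈ Finset.range (l + 1),
        MvPolynomial.C (g.coeff j) * MvPolynomial.X 1 ^ (k₂ * j)
          * MvPolynomial.X 0 ^ (k₁ * (l - j))) = s ^ (k₁ * k₂ * l) * g.eval 1 := by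
  rw [Polynomial.eval_eq_sum_range' (Nat.lt_succ_of_le hg), Finset.mul_sum, map_sum]
  refine Finset.sum_congr rfl fun j hj => ?_
  obtain ⟨i, rfl⟩ := Nat.exists_eq_add_of_le (Nat.lt_succ_iff.mp (Finset.mem_range.mp hj))
  simp only [map_mul, map_pow, MvPolynomial.eval_C, MvPolynomial.eval_X, Matrix.cons_val_zero,
    Matrix.cons_val_one, Nat.add_sub_cancel_left, one_pow, mul_one]
  ring

/-- Case (b) of the main theorem, branch-curve computation: `F = (u,v)` maps the
parametrized curve `s ↦ (s^{k₂}, s^{k₁})` onto the curve `s ↦ (s^{d₂}, s^{d₁})`. -/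
theorem stmt_4 (k₁ k₂ l₁ l₂ : ℕ) (hk₁ : 1 ≤ k₁) (hk₂ : 1 ≤ k₂)
    (m₁ m₂ d₁ d₂ : ℕ)
    (hm₁ : m₁ = k₂ * l₂ + 1) (hm₂ : m₂ = k₁ * l₁ + 1)
    (hd₁ : d₁ = k₁ * m₁) (hd₂ : d₂ = k₂ * m₂)
    (g₁ g₂ : Polynomial ℂ) (hdeg₁ : g₁.natDegree ≤ l₁) (hdeg₂ : g₂.natDegree ≤ l₂)
    (hg₁1 : g₁.eval 1 = 1) (hg₂1 : g₂.eval 1 = 1)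
    (G₁ G₂ u v : MvPolynomial (Fin 2) ℂ)
    (hG₁ : G₁ = ∑ j ∈ Finset.range (l₁ + 1),
        MvPolynomial.C (g₁.coeff j) * MvPolynomial.X 1 ^ (k₂ * j)
          * MvPolynomial.X 0 ^ (k₁ * (l₁ - j)))
    (hG₂ : G₂ = ∑ j ∈ Finset.range (l₂ + 1),
        MvPolynomial.C (g₂.coeff j) * MvPolynomial.X 1 ^ (k₂ * j)
          * MvPolynomial.X 0 ^ (k₁ * (l₂ - j)))
    (hu : u = MvPolynomial.X 0 * G₁) (hv : v = MvPolynomial.X 1 * G₂) :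
    ∀ s : ℂ, MvPolynomial.eval ![s ^ k₂, s ^ k₁] u = s ^ d₂ ∧
      MvPolynomial.eval ![s ^ k₂, s ^ k₁] v = s ^ d₁ := by
  intro s
  subst hu hv hG₁ hG₂ hd₁ hd₂ hm₁ hm₂
  rw [map_mul, map_mul, eval_weighted_homogenization k₁ k₂ l₁ g₁ hdeg₁,
    eval_weighted_homogenization k₁ k₂ l₂ g₂ hdeg₂, hg₁1, hg₂1]
  simp only [MvPolynomial.eval_X, Matrix.cons_val_zero, Matrix.cons_val_one]
  constructor <;> ring
end

section
/- Let l₁,k₁,k₂ ≥ 1 and l₂ ≥ 0 be integers with l₁k₁k₂ ≥ 2, gcd(k₁,k₂) = 1 and gcd(l₁,d₁) = 1, where d₁ = k₁+k₂+l₂k₁k₂; set d₂ = l₁k₁k₂, m₂ = l₁k₁ and n = l₁+l₂+1. Then there exist polynomials g₁,g₂ ∈ ℂ[t] and μ ∈ ℂ, μ ≠ 0, such that: deg gᵢ = lᵢ, gᵢ(0) ≠ 0, gᵢ(1) = 1, g₁ and g₂ are squarefree and coprime, and m₂·g₁g₂ − d₁·t·g₁′·g₂ + d₂·t·g₁·g₂′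 = μ·(t−1)^{n−1} in ℂ[t]. -/
namespace MvPolynomial

variable {K σ ι : Type*} [Field K]

theorem height_vanishingIdeal_singleton [IsAlgClosed K] [Finite σ] (x : σ → K) :
    (Nat.card σ : WithBot ℕ∞) ≤ (vanishingIdeal K {x}).height := by
  have hdim : ringKrullDim (MvPolynomial σ K) = Nat.card σ := by
    rw [ringKrullDim_of_isNoetherianRing, ringKrullDim_eq_zero_of_field, zero_add]
  rw [← hdim, ringKrullDim_le_iff_isMaximal_height_le]
  intro M hM
  obtain ⟨y, rfl⟩ := eq_vanishingIdeal_singleton_of_isMaximal K hM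
  let e : MvPolynomial σ K ≃ₐ[K] MvPolynomial σ K :=
    AlgEquiv.ofAlgHom (aeval fun i ↦ X i + C (y i - x i)) (aeval fun i ↦ X i - C (y i - x i))
      (by ext; simp) (by ext; simp)
  have hcomap : (vanishingIdeal K {x}).comap (e : MvPolynomial σ K ≃+* MvPolynomial σ K) =
      vanishingIdeal K {y} := by
    ext p
    have h : (aeval x).comp (e : MvPolynomial σ K →ₐ[K] MvPolynomial σ K) = aeval y := by
      ext i; simp [e]
    simpa using Eq.congr_left (DFunLike.congr_fun h p)
  rw [← hcomap, RingEquiv.height_comap]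

theorem exists_ne_forall_eval_eq_zero [IsAlgClosed K] [Fintype σ] [Fintype ι]
    (hcard : Fintype.card ι < Fintype.card σ) (f : ι → MvPolynomial σ K) (x : σ → K)
    (hx : ∀ i, eval x (f i) = 0) : ∃ y ≠ x, ∀ i, eval y (f i) = 0 := by
  by_contra! h
  have hzero : zeroLocus K (Ideal.span (Set.range f)) = {x} := by
    rw [zeroLocus_span]
    ext y
    simp only [Set.forall_mem_range, Set.mem_ofPred_eq, Set.mem_singleton_iff, aeval_eq_eval]
    refine ⟨fun hy ↦ by_contra fun hne ↦ ?_, fun hy ↦ hy ▸ hx⟩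
    obtain ⟨i, hi⟩ := h y hne
    exact hi (hy i)
  have hrad : (Ideal.span (Set.range f)).radical = vanishingIdeal K {x} := by
    rw [← hzero, vanishingIdeal_zeroLocus_eq_radical]
  have hmin : vanishingIdeal K {x} ∈ (Ideal.span (Set.range f)).minimalPrimes := by
    rw [← Ideal.radical_minimalPrimes, hrad, Ideal.minimalPrimes_eq_subsingleton_self]
    rfl
  have h₁ := Ideal.height_le_card_of_mem_minimalPrimes_span (Set.finite_range f) hmin
  have h₂ := height_vanishingIdeal_singleton x
  have h₃ : (Set.range f).ncard ≤ Fintype.card ι := by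
    rw [← Set.image_univ, ← Nat.card_eq_fintype_card, ← Set.ncard_univ]
    exact Set.ncard_image_le
  have h₄ : (Nat.card σ : WithBot ℕ∞) ≤ ((Set.range f).ncard : ℕ∞) :=
    h₂.trans (WithBot.coe_le_coe.2 h₁)
  rw [Nat.card_eq_fintype_card] at h₄
  have h₅ : Fintype.card σ ≤ (Set.range f).ncard := by exact_mod_cast h₄
  omega

end MvPolynomial

namespace Polynomial

section CommRing

variable {R S : Type*} [CommRing R] [CommRing S]

/-- The bilinear differential operator `a f g - b t f' g + c t f g'`, which is
`f g` times the logarithmic derivative `t d/dt` of `t ^ a * g ^ c / f ^ b`. -/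
noncomputable def logWronskian (a b c : R) (f g : R[X]) : R[X] :=
  C a * (f * g) - C b * X * derivative f * g + C c * X * f * derivative g

theorem map_logWronskian (φ : R →+* S) (a b c : R) (f g : R[X]) :
    (logWronskian a b c f g).map φ =
      logWronskian (φ a) (φ b) (φ c) (f.map φ) (g.map φ) := by
  simp [logWronskian, derivative_map]

theorem logWronskian_comp_C_mul_X (a b c r : R) (f g : R[X]) :
    logWronskian a b c (f.comp (C r * X)) (g.comp (C r * X)) =
      (logWronskian a b c f g).comp (C r * X) := by
  simp only [logWronskian, derivative_comp, add_comp, sub_comp, mul_comp, C_comp, X_comp,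
    derivative_mul, derivative_C, derivative_X]
  ring

theorem logWronskian_C_mul_C_mul (a b c r s : R) (f g : R[X]) :
    logWronskian a b c (C r * f) (C s * g) = C (r * s) * logWronskian a b c f g := by
  simp only [logWronskian, derivative_C_mul, C_mul]
  ring

theorem natDegree_X_mul_derivative_le (f : R[X]) : (X * derivative f).natDegree ≤ f.natDegree := by
  rw [natDegree_le_iff_coeff_eq_zero]
  rintro (_ | m) hm
  · simp
  · rw [coeff_X_mul, coeff_derivative, coeff_eq_zero_of_natDegree_lt hm, zero_mul]

theorem coeff_X_mul_derivative (f : R[X]) (k : ℕ) : (X * derivative f).coeff k = k * f.coeff k := by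
  cases k with
  | zero => simp
  | succ k => rw [coeff_X_mul, coeff_derivative]; push_cast; ring

theorem logWronskian_eq (a b c : R) (f g : R[X]) :
    logWronskian a b c f g =
      C a * (f * g) - C b * (X * derivative f * g) + C c * (f * (X * derivative g)) := by
  rw [logWronskian]
  ring

theorem natDegree_logWronskian_le (a b c : R) (f g : R[X]) :
    (logWronskian a b c f g).natDegree ≤ f.natDegree + g.natDegree := by
  have hf := natDegree_X_mul_derivative_le f
  have hg := natDegree_X_mul_derivative_le g
  rw [logWronskian_eq]
  refine natDegree_add_le_of_degree_le
    ((natDegree_sub_le_of_le (m := f.natDegree + g.natDegree) (n := f.natDegree + g.natDegree)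
      ?_ ?_).trans (max_self _).le) ?_ <;>
  refine (natDegree_C_mul_le _ _).trans (natDegree_mul_le.trans ?_) <;>
  omega

theorem coeff_logWronskian_natDegree_add_natDegree (a b c : R) (f g : R[X]) :
    (logWronskian a b c f g).coeff (f.natDegree + g.natDegree) =
      (a - b * f.natDegree + c * g.natDegree) * (f.leadingCoeff * g.leadingCoeff) := by
  rw [logWronskian_eq, coeff_add, coeff_sub, coeff_C_mul, coeff_C_mul, coeff_C_mul,
    coeff_mul_add_eq_of_natDegree_le le_rfl le_rfl,
    coeff_mul_add_eq_of_natDegree_le (natDegree_X_mul_derivative_le f) le_rfl,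
    coeff_mul_add_eq_of_natDegree_le le_rfl (natDegree_X_mul_derivative_le g),
    coeff_X_mul_derivative, coeff_X_mul_derivative, leadingCoeff, leadingCoeff]
  ring

theorem natDegree_logWronskian [IsDomain R] {a b c : R} {f g : R[X]} (hf : f ≠ 0) (hg : g ≠ 0)
    (h : a - b * f.natDegree + c * g.natDegree ≠ 0) :
    (logWronskian a b c f g).natDegree = f.natDegree + g.natDegree := by
  refine natDegree_eq_of_le_of_coeff_ne_zero (natDegree_logWronskian_le a b c f g) ?_
  rw [coeff_logWronskian_natDegree_add_natDegree]
  exact mul_ne_zero h (mul_ne_zero (leadingCoeff_ne_zero.2 hf) (leadingCoeff_ne_zero.2 hg))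

theorem rootMultiplicity_le_natDegree [IsDomain R] (f : R[X]) (z : R) :
    f.rootMultiplicity z ≤ f.natDegree := by
  classical
  rw [← count_roots]
  exact (Multiset.count_le_card _ _).trans (card_roots' f)

theorem rootMultiplicity_logWronskian [IsDomain R] {a b c μ z : R} {f g : R[X]} {N : ℕ}
    (hz : z ≠ 0) (hf : f ≠ 0) (hg : g ≠ 0) (hN : f.natDegree + g.natDegree ≤ N)
    (h : logWronskian a b c f g = C μ * (X - C z) ^ N) :
    c * g.rootMultiplicity z = b * f.rootMultiplicity z := by
  obtain ⟨u, hfu, hu⟩ := exists_eq_pow_rootMultiplicity_mul_and_not_dvd f hf z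
  obtain ⟨v, hgv, hv⟩ := exists_eq_pow_rootMultiplicity_mul_and_not_dvd g hg z
  have hp : f.rootMultiplicity z ≤ f.natDegree := rootMultiplicity_le_natDegree f z
  have hq : g.rootMultiplicity z ≤ g.natDegree := rootMultiplicity_le_natDegree g z
  generalize f.rootMultiplicity z = p at *
  generalize g.rootMultiplicity z = q at *
  rw [dvd_iff_isRoot, IsRoot.def] at hu hv
  have hder (w : R[X]) (k : ℕ) : (X - C z) * derivative ((X - C z) ^ k * w) =
      (X - C z) ^ k * (C (k : R) * w + (X - C z) * derivative w) := by
    cases k with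
    | zero => simp
    | succ k =>
      rw [derivative_mul, derivative_X_sub_C_pow, Nat.add_sub_cancel]
      ring
  have hmul : (X - C z) * logWronskian a b c f g = (X - C z) ^ (p + q) *
      ((X - C z) * (C a * (u * v)) - C b * X * (C (p : R) * u + (X - C z) * derivative u) * v +
        C c * X * u * (C (q : R) * v + (X - C z) * derivative v)) := by
    calc _ = (X - C z) * (C a * (f * g)) - C b * X * ((X - C z) * derivative f) * g +
          C c * X * f * ((X - C z) * derivative g) := by rw [logWronskian]; ring
      _ = _ := by rw [hfu, hgv, hder, hder]; ring
  rw [h, ← Nat.add_sub_of_le (show p + q ≤ N by omega), pow_add,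
    show ∀ x y z w : R[X], x * (y * (z * w)) = z * (x * (y * w)) by intros; ring] at hmul
  have heval := congrArg (eval z) (mul_left_cancel₀ (pow_ne_zero _ (X_sub_C_ne_zero z)) hmul)
  simp only [eval_add, eval_sub, eval_mul, eval_X, eval_C, sub_self, zero_mul, add_zero,
    zero_sub] at heval
  have hne : z * (eval z u * eval z v) ≠ 0 := mul_ne_zero hz (mul_ne_zero hu hv)
  apply mul_right_cancel₀ hne
  linear_combination -heval

/-- The polynomial `1 + x₀ t + ⋯ + xₗ₋₁ t ^ l`. -/
noncomputable def oneAddTail {l : ℕ} (x : Fin l → R) : R[X] :=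
  1 + ∑ i, C (x i) * X ^ ((i : ℕ) + 1)

theorem map_oneAddTail {l : ℕ} (φ : R →+* S) (x : Fin l → R) :
    (oneAddTail x).map φ = oneAddTail fun i ↦ φ (x i) := by
  simp [oneAddTail, Polynomial.map_sum]

theorem natDegree_oneAddTail_le {l : ℕ} (x : Fin l → R) : (oneAddTail x).natDegree ≤ l := by
  refine natDegree_add_le_of_degree_le (by simp) (natDegree_sum_le_of_forall_le _ _ fun i _ ↦ ?_)
  exact (natDegree_C_mul_X_pow_le _ _).trans i.2

theorem eval_zero_oneAddTail {l : ℕ} (x : Fin l → R) : (oneAddTail x).eval 0 = 1 := by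
  simp [oneAddTail, eval_finsetSum]

theorem coeff_oneAddTail_succ {l : ℕ} (x : Fin l → R) (i : Fin l) :
    (oneAddTail x).coeff (i + 1) = x i := by
  simp [oneAddTail, coeff_one, coeff_X_pow, Fin.val_inj]

theorem oneAddTail_ne_zero [Nontrivial R] {l : ℕ} (x : Fin l → R) : oneAddTail x ≠ 0 := by
  intro h
  simpa [h] using eval_zero_oneAddTail x

theorem eq_zero_of_natDegree_oneAddTail {l : ℕ} {x : Fin l → R}
    (h : (oneAddTail x).natDegree = 0) : x = 0 := by
  ext i
  rw [← coeff_oneAddTail_succ x i, coeff_eq_zero_of_natDegree_lt (by omega), Pi.zero_apply]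

theorem oneAddTail_zero {l : ℕ} : oneAddTail (fun _ : Fin l ↦ (0 : R)) = 1 := by
  simp [oneAddTail]

end CommRing

section Field

variable {K : Type*} [Field K] [IsAlgClosed K]

theorem isCoprime_of_forall_eq_of_eval_ne_zero {p q : K[X]} {z : K} (hp : p.eval z ≠ 0)
    (h : ∀ w, p.eval w = 0 → q.eval w = 0 → w = z) : IsCoprime p q := by
  rw [isCoprime_iff_aeval_ne_zero_of_isAlgClosed (k := K) K]
  intro w
  by_contra! hw
  simp only [coe_aeval_eq_eval] at hw
  exact hp (h w hw.1 hw.2 ▸ hw.1)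

theorem exists_logWronskian_oneAddTail_eq {a b c : K} {l₁ l₂ : ℕ}
    (hnd : ∀ i ≤ l₁, ∀ j ≤ l₂, a - b * i + c * j ≠ 0) :
    ∃ (x : Fin l₁ → K) (y : Fin l₂ → K) (s : K), s ≠ 0 ∧
      logWronskian a b c (oneAddTail x) (oneAddTail y) =
        C a * (1 - C s * X) ^ (l₁ + l₂) := by
  let σ := Option (Fin l₁ ⊕ Fin l₂)
  let F : (MvPolynomial σ K)[X] :=
    logWronskian (.C a) (.C b) (.C c)
      (oneAddTail fun i ↦ MvPolynomial.X (some (.inl i)))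
      (oneAddTail fun j ↦ MvPolynomial.X (some (.inr j))) -
    C (.C a) * (1 - C (MvPolynomial.X none) * X) ^ (l₁ + l₂)
  have hF (z : σ → K) : F.map (MvPolynomial.eval z) =
      logWronskian a b c (oneAddTail fun i ↦ z (some (.inl i)))
        (oneAddTail fun j ↦ z (some (.inr j))) - C a * (1 - C (z none) * X) ^ (l₁ + l₂) := by
    simp [F, map_logWronskian, map_oneAddTail]
  have hcard : Fintype.card (Fin (l₁ + l₂)) < Fintype.card σ := by simp [σ]
  obtain ⟨z, hz, hzF⟩ := MvPolynomial.exists_ne_forall_eval_eq_zero hcard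
    (fun k ↦ F.coeff (k + 1)) (fun _ ↦ 0) fun k ↦ by
      rw [← coeff_map, hF, oneAddTail_zero, oneAddTail_zero]
      simp [logWronskian]
  set x : Fin l₁ → K := fun i ↦ z (some (.inl i))
  set y : Fin l₂ → K := fun j ↦ z (some (.inr j))
  have hx := natDegree_oneAddTail_le x
  have hy := natDegree_oneAddTail_le y
  have heq : logWronskian a b c (oneAddTail x) (oneAddTail y) =
      C a * (1 - C (z none) * X) ^ (l₁ + l₂) := by
    rw [← sub_eq_zero, ← hF]
    ext (_ | k)
    · rw [hF, coeff_zero_eq_eval_zero]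
      simp [logWronskian, eval_zero_oneAddTail]
    · by_cases hk : k < l₁ + l₂
      · rw [coeff_map]
        exact hzF ⟨k, hk⟩
      · refine coeff_eq_zero_of_natDegree_lt (lt_of_le_of_lt ?_ (Nat.lt_succ_of_le (not_lt.1 hk)))
        rw [hF]
        have hW := natDegree_logWronskian_le a b c (oneAddTail x) (oneAddTail y)
        have hR : (C a * (1 - C (z none) * X) ^ (l₁ + l₂)).natDegree ≤ l₁ + l₂ := by
          compute_degree
        exact (natDegree_sub_le_of_le (hW.trans (add_le_add hx hy)) hR).trans (max_self _).le
  refine ⟨x, y, z none, fun hs ↦ hz ?_, heq⟩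
  have hdeg := natDegree_logWronskian (oneAddTail_ne_zero x) (oneAddTail_ne_zero y)
    (hnd _ hx _ hy)
  rw [heq, hs, C_0, zero_mul, sub_zero, one_pow, mul_one, natDegree_C] at hdeg
  have hx0 := eq_zero_of_natDegree_oneAddTail (x := x) (by omega)
  have hy0 := eq_zero_of_natDegree_oneAddTail (x := y) (by omega)
  funext i
  rcases i with _ | i | j
  · exact hs
  · exact congrFun hx0 i
  · exact congrFun hy0 j

theorem exists_logWronskian_eq {a b c : K} {l₁ l₂ : ℕ}
    (hnd : ∀ i ≤ l₁, ∀ j ≤ l₂, a - b * i + c * j ≠ 0) :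
    ∃ f g : K[X], f.natDegree = l₁ ∧ g.natDegree = l₂ ∧ f.eval 0 = 1 ∧ g.eval 0 = 1 ∧
      logWronskian a b c f g = C a * (1 - X) ^ (l₁ + l₂) := by
  obtain ⟨x, y, s, hs, h⟩ := exists_logWronskian_oneAddTail_eq hnd
  have ha : a ≠ 0 := by simpa using hnd 0 (Nat.zero_le _) 0 (Nat.zero_le _)
  have hx := natDegree_oneAddTail_le x
  have hy := natDegree_oneAddTail_le y
  have hdeg := natDegree_logWronskian (oneAddTail_ne_zero x) (oneAddTail_ne_zero y)
    (hnd _ hx _ hy)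
  have hlin : (1 - C s * X : K[X]).natDegree = 1 := by
    rw [natDegree_sub_eq_right_of_natDegree_lt] <;> simp [natDegree_C_mul_X s hs]
  rw [h, natDegree_C_mul ha, natDegree_pow, hlin] at hdeg
  have hcomp : (C s⁻¹ * X : K[X]).natDegree = 1 := natDegree_C_mul_X _ (inv_ne_zero hs)
  refine ⟨(oneAddTail x).comp (C s⁻¹ * X), (oneAddTail y).comp (C s⁻¹ * X), ?_, ?_, ?_, ?_, ?_⟩
  · rw [natDegree_comp, hcomp]; omega
  · rw [natDegree_comp, hcomp]; omega
  · simp [eval_comp, eval_zero_oneAddTail]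
  · simp [eval_comp, eval_zero_oneAddTail]
  · rw [logWronskian_comp_C_mul_X, h]
    simp [← mul_assoc, ← C_mul, hs]

end Field

end Polynomial

theorem Nat.Coprime.add_add_mul_right {k₁ k₂ : ℕ} (h : k₁.Coprime k₂) (l : ℕ) :
    (k₁ + k₂ + l * k₁ * k₂).Coprime (k₁ * k₂) := by
  refine Nat.Coprime.mul_right ?_ ?_
  · rw [show k₁ + k₂ + l * k₁ * k₂ = k₂ + (1 + l * k₂) * k₁ by ring,
      Nat.coprime_add_mul_right_left]
    exact h.symm
  · rw [show k₁ + k₂ + l * k₁ * k₂ = k₁ + (1 + l * k₁) * k₂ by ring,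
      Nat.coprime_add_mul_right_left]
    exact h

theorem eq_zero_and_eq_zero_of_mul_eq_mul {l₁ l₂ k₁ k₂ d p q : ℕ} (hk₁ : 1 ≤ k₁)
    (hk₂ : 1 ≤ k₂) (hcop : k₁.Coprime k₂) (hcop' : l₁.Coprime d)
    (hd : d = k₁ + k₂ + l₂ * k₁ * k₂) (hq : q ≤ l₂) (h : l₁ * k₁ * k₂ * q = d * p) :
    p = 0 ∧ q = 0 := by
  have hcopd : d.Coprime (l₁ * k₁ * k₂) := by
    rw [mul_assoc]
    exact hcop'.symm.mul_right (hd ▸ hcop.add_add_mul_right l₂)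
  have hlt : q < d := by nlinarith [Nat.mul_le_mul (Nat.mul_le_mul_left l₂ hk₁) hk₂]
  have hq0 : q = 0 := Nat.eq_zero_of_dvd_of_lt (hcopd.dvd_of_dvd_mul_left ⟨p, h⟩) hlt
  refine ⟨?_, hq0⟩
  rw [hq0, mul_zero] at h
  exact (Nat.mul_eq_zero.1 h.symm).resolve_left (by omega)

theorem add_mul_ne_mul_of_coprime {l₁ l₂ k₁ k₂ d i j : ℕ} (hl₁ : 1 ≤ l₁) (hk₁ : 1 ≤ k₁)
    (hk₂ : 1 ≤ k₂) (hcop : l₁.Coprime d) (hd : d = k₁ + k₂ + l₂ * k₁ * k₂) (hi : i ≤ l₁)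
    (hj : j ≤ l₂) : l₁ * k₁ + l₁ * k₁ * k₂ * j ≠ d * i := by
  intro h
  have hpos : 0 < l₁ * k₁ := Nat.mul_pos hl₁ hk₁
  obtain rfl | hi0 := Nat.eq_zero_or_pos i
  · omega
  have hdvd : l₁ ∣ i := hcop.dvd_of_dvd_mul_left ⟨k₁ + k₁ * k₂ * j, by rw [← h]; ring⟩
  obtain rfl : i = l₁ := le_antisymm hi (Nat.le_of_dvd hi0 hdvd)
  have h' : k₁ + k₁ * k₂ * j = d := Nat.eq_of_mul_eq_mul_left hl₁ (by rw [mul_comm i d, ← h]; ring)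
  have hle : k₁ * k₂ * j ≤ k₁ * k₂ * l₂ := Nat.mul_le_mul_left _ hj
  have hcomm : l₂ * k₁ * k₂ = k₁ * k₂ * l₂ := by ring
  omega

open Polynomial in
/-- Existence statement (Case (a) of the main theorem + Zannier's theorem): there exist
squarefree coprime polynomials `g₁, g₂` of degrees `l₁, l₂` with `gᵢ(0) ≠ 0`, `gᵢ(1) = 1`,
and `μ ≠ 0` satisfying `m₂·g₁g₂ - d₁·t·g₁'·g₂ + d₂·t·g₁·g₂' = μ·(t-1)^{n-1}`. -/
theorem stmt_5 (l₁ k₁ k₂ l₂ : ℕ) (hl₁ : 1 ≤ l₁) (hk₁ : 1 ≤ k₁) (hk₂ : 1 ≤ k₂)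
    (d₁ d₂ m₂ n : ℕ)
    (hd₁ : d₁ = k₁ + k₂ + l₂ * k₁ * k₂) (hd₂ : d₂ = l₁ * k₁ * k₂)
    (hm₂ : m₂ = l₁ * k₁) (hn : n = l₁ + l₂ + 1)
    (hbig : 2 ≤ l₁ * k₁ * k₂)
    (hcop : Nat.gcd k₁ k₂ = 1) (hcop' : Nat.gcd l₁ d₁ = 1) :
    ∃ (g₁ g₂ : Polynomial ℂ) (μ : ℂ), μ ≠ 0 ∧
      g₁.natDegree = l₁ ∧ g₂.natDegree = l₂ ∧
      g₁.eval 0 ≠ 0 ∧ g₂.eval 0 ≠ 0 ∧ g₁.eval 1 = 1 ∧ g₂.eval 1 = 1 ∧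
      Squarefree g₁ ∧ Squarefree g₂ ∧ IsCoprime g₁ g₂ ∧
      Polynomial.C (m₂ : ℂ) * (g₁ * g₂)
          - Polynomial.C (d₁ : ℂ) * Polynomial.X * Polynomial.derivative g₁ * g₂
          + Polynomial.C (d₂ : ℂ) * Polynomial.X * g₁ * Polynomial.derivative g₂
        = Polynomial.C μ * (Polynomial.X - 1) ^ (n - 1) := by
  have hnd : ∀ i ≤ l₁, ∀ j ≤ l₂, (m₂ : ℂ) - d₁ * i + d₂ * j ≠ 0 := by
    intro i hi j hj h
    refine add_mul_ne_mul_of_coprime hl₁ hk₁ hk₂ hcop' hd₁ hi hj ?_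
    rw [← hd₂, ← hm₂]
    have h' : ((m₂ + d₂ * j : ℕ) : ℂ) = (d₁ * i : ℕ) := by
      push_cast
      linear_combination h
    exact_mod_cast h'
  obtain ⟨f, g, hf, hg, hf0, hg0, hfg⟩ := exists_logWronskian_eq hnd
  have hm0 : (m₂ : ℂ) ≠ 0 := by simpa using hnd 0 (Nat.zero_le _) 0 (Nat.zero_le _)
  have hfne : f ≠ 0 := by rintro rfl; simp at hf0
  have hgne : g ≠ 0 := by rintro rfl; simp at hg0
  have hfg' : logWronskian (m₂ : ℂ) d₁ d₂ f g =
      C ((m₂ : ℂ) * (-1) ^ (l₁ + l₂)) * (X - C 1) ^ (l₁ + l₂) := by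
    rw [hfg, C_mul, C_pow, mul_assoc, ← mul_pow]
    simp
  have hmul := rootMultiplicity_logWronskian one_ne_zero hfne hgne (by rw [hf, hg]) hfg'
  have hq : g.rootMultiplicity 1 ≤ l₂ :=
    hg ▸ rootMultiplicity_le_natDegree g 1
  obtain ⟨hp0, hq0⟩ := eq_zero_and_eq_zero_of_mul_eq_mul hk₁ hk₂ hcop hcop' hd₁ hq
    (p := f.rootMultiplicity 1) (by rw [← hd₂]; exact_mod_cast hmul)
  have hf1 : f.eval 1 ≠ 0 := fun h ↦ ((rootMultiplicity_pos hfne).2 h).ne' hp0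
  have hg1 : g.eval 1 ≠ 0 := fun h ↦ ((rootMultiplicity_pos hgne).2 h).ne' hq0
  have hroot (w : ℂ) (hw : (logWronskian (m₂ : ℂ) d₁ d₂ f g).eval w = 0) : w = 1 := by
    rw [hfg] at hw
    simp only [eval_mul, eval_C, eval_pow, eval_sub, eval_one, eval_X] at hw
    exact (sub_eq_zero.1 (eq_zero_of_pow_eq_zero ((mul_eq_zero.1 hw).resolve_left hm0))).symm
  have hcopfg : IsCoprime f g := isCoprime_of_forall_eq_of_eval_ne_zero hf1 fun w hfw hgw ↦
    hroot w (by simp [logWronskian, hfw, hgw])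
  have hsepf : f.Separable := isCoprime_of_forall_eq_of_eval_ne_zero hf1 fun w hfw hfw' ↦
    hroot w (by simp [logWronskian, hfw, hfw'])
  have hsepg : g.Separable := isCoprime_of_forall_eq_of_eval_ne_zero hg1 fun w hgw hgw' ↦
    hroot w (by simp [logWronskian, hgw, hgw'])
  have huf : IsUnit (C (f.eval 1)⁻¹) := isUnit_C.2 (isUnit_iff_ne_zero.2 (inv_ne_zero hf1))
  have hug : IsUnit (C (g.eval 1)⁻¹) := isUnit_C.2 (isUnit_iff_ne_zero.2 (inv_ne_zero hg1))
  refine ⟨C (f.eval 1)⁻¹ * f, C (g.eval 1)⁻¹ * g,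
    (f.eval 1)⁻¹ * (g.eval 1)⁻¹ * (m₂ * (-1) ^ (l₁ + l₂)), ?_, ?_, ?_, ?_, ?_, ?_, ?_,
    (hsepf.unit_mul huf).squarefree, (hsepg.unit_mul hug).squarefree, ?_, ?_⟩
  · simp [hf1, hg1, hm0]
  · rw [natDegree_C_mul (inv_ne_zero hf1), hf]
  · rw [natDegree_C_mul (inv_ne_zero hg1), hg]
  · simp [hf0, hf1]
  · simp [hg0, hg1]
  · simp [hf1]
  · simp [hg1]
  · exact (isCoprime_mul_unit_left_left huf _ _).2 ((isCoprime_mul_unit_left_right hug _ _).2 hcopfg)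
  · change logWronskian _ _ _ _ _ = _
    rw [logWronskian_C_mul_C_mul, hfg', hn, Nat.add_sub_cancel, C_1, ← mul_assoc, ← C_mul]
end
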